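/- arXiv:2009.10655 — 3 statements merged into one kernel-verified Lean document; each statement's English description precedes it below -/
import Mathlib

section
/- For every positive integer n, any sequence C = (c_k)_{k=0}^{n-1} with c_k ∈ {P_{n,k}, Q_{n,k}} for each 0 ≤ k ≤ n-1 is log-concave: c_k^2 ≥ c_{k-1} c_{k+1} for all 1 ≤ k ≤ n-2. -/
/-- Number of excedances of a permutation of `{1,…,n}` (encoded on `Fin n`):
`exc σ = |{i : σ(i) > i}|`. -/
def excA {n : ℕ} (σ : Equiv.Perm (Fin n)) : ℕ :=
  (Finset.univ.filter (fun i : Fin n => i < σ i)).card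

/-- `P n k`: number of even permutations of `[n]` with exactly `k` excedances. -/
def P (n k : ℕ) : ℕ :=
  (Finset.univ.filter (fun σ : Equiv.Perm (Fin n) =>
    Equiv.Perm.sign σ = 1 ∧ excA σ = k)).card

/-- `Q n k`: number of odd permutations of `[n]` with exactly `k` excedances. -/
def Q (n k : ℕ) : ℕ :=
  (Finset.univ.filter (fun σ : Equiv.Perm (Fin n) =>
    Equiv.Perm.sign σ = -1 ∧ excA σ = k)).card

/-- Number of permutations of `Fin n` with sign `s` and exactly `k` excedances. -/
def signedExcCount (s : ℤˣ) (n k : ℕ) : ℕ :=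
  (Finset.univ.filter (fun σ : Equiv.Perm (Fin n) => Equiv.Perm.sign σ = s ∧ excA σ = k)).card

theorem excA_eq_sum {n : ℕ} (σ : Equiv.Perm (Fin n)) :
    excA σ = ∑ i, if i < σ i then 1 else 0 := by
  rw [excA, Finset.card_filter]

theorem excA_decomposeFin_symm_zero {n : ℕ} (e : Equiv.Perm (Fin n)) :
    excA (Equiv.Perm.decomposeFin.symm (0, e)) = excA e := by
  rw [excA_eq_sum, excA_eq_sum, Fin.sum_univ_succ]
  simp [Equiv.swap_self]

theorem excA_decomposeFin_symm_succ {n : ℕ} (e : Equiv.Perm (Fin n)) (i : Fin n) :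
    excA (Equiv.Perm.decomposeFin.symm ((e i).succ, e)) =
      excA e + if i < e i then 0 else 1 := by
  have h (x : Fin n) : Equiv.swap 0 (e i).succ (e x).succ = if x = i then 0 else (e x).succ := by
    split_ifs with hx
    · simp [hx]
    · exact Equiv.swap_apply_of_ne_of_ne (Fin.succ_ne_zero _) (by simpa using hx)
  rw [excA_eq_sum, excA_eq_sum, Fin.sum_univ_succ, ← Finset.add_sum_erase _ _ (Finset.mem_univ i),
    ← Finset.add_sum_erase (a := i) _ (fun x => if x < e x then 1 else 0) (Finset.mem_univ i)]
  have hs : ∑ x ∈ Finset.univ.erase i,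
      (if x.succ < Equiv.Perm.decomposeFin.symm ((e i).succ, e) x.succ then 1 else 0) =
      ∑ x ∈ Finset.univ.erase i, if x < e x then 1 else 0 := by
    refine Finset.sum_congr rfl fun x hx => ?_
    simp [h, Finset.ne_of_mem_erase hx]
  rw [hs]
  simp only [Equiv.Perm.decomposeFin_symm_apply_zero, Equiv.Perm.decomposeFin_symm_apply_succ, h]
  simp
  split_ifs <;> omega

theorem sum_insertion_count {n : ℕ} (e : Equiv.Perm (Fin n)) (k : ℕ) :
    (∑ i, if (excA e + if i < e i then 0 else 1) = k then (1 : ℚ) else 0) =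
      (k : ℚ) * (if excA e = k then 1 else 0) +
        (n + 1 - k : ℚ) * (if excA e + 1 = k then 1 else 0) := by
  have hc : (∑ i, if i < e i then (1 : ℚ) else 0) = excA e := by
    rw [excA_eq_sum]; push_cast; rfl
  have key (i : Fin n) : (if (excA e + if i < e i then 0 else 1) = k then (1 : ℚ) else 0) =
      (if i < e i then (1 : ℚ) else 0) * (if excA e = k then 1 else 0) +
      (1 - if i < e i then (1 : ℚ) else 0) * (if excA e + 1 = k then 1 else 0) := by
    split_ifs <;> simp_all
  simp_rw [key]
  rw [Finset.sum_add_distrib, ← Finset.sum_mul, ← Finset.sum_mul, Finset.sum_sub_distrib, hc]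
  simp only [Finset.sum_const, Finset.card_univ, Fintype.card_fin, nsmul_eq_mul, mul_one]
  congr 1
  · split_ifs with h
    · rw [h]
    · simp
  · split_ifs with h
    · rw [← h]; push_cast; ring
    · simp

theorem signedExcCount_cast (s : ℤˣ) (n k : ℕ) :
    (signedExcCount s n k : ℚ) =
      ∑ σ : Equiv.Perm (Fin n), (if Equiv.Perm.sign σ = s then 1 else 0) *
        (if excA σ = k then 1 else 0) := by
  rw [signedExcCount, Finset.card_filter]
  push_cast
  refine Finset.sum_congr rfl fun σ _ => ?_
  split_ifs <;> simp_all

theorem signedExcCount_succ (s : ℤˣ) (n k : ℕ) :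
    (signedExcCount s (n + 1) k : ℚ) = signedExcCount s n k + k * signedExcCount (-s) n k +
      (n + 1 - k) * ∑ σ : Equiv.Perm (Fin n), (if Equiv.Perm.sign σ = -s then 1 else 0) *
        (if excA σ + 1 = k then 1 else 0) := by
  simp only [signedExcCount_cast]
  rw [← Equiv.sum_comp Equiv.Perm.decomposeFin.symm, Fintype.sum_prod_type, Fin.sum_univ_succ,
    add_assoc]
  congr 1
  · refine Finset.sum_congr rfl fun e _ => ?_
    rw [excA_decomposeFin_symm_zero, Equiv.Perm.decomposeFin.symm_sign]
    simp
  · rw [Finset.sum_comm, Finset.mul_sum, Finset.mul_sum, ← Finset.sum_add_distrib]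
    refine Finset.sum_congr rfl fun e _ => ?_
    rw [← Equiv.sum_comp e]
    simp only [excA_decomposeFin_symm_succ, Equiv.Perm.decomposeFin.symm_sign,
      Fin.succ_ne_zero, if_false, neg_mul, one_mul, neg_eq_iff_eq_neg]
    rw [← Finset.mul_sum, sum_insertion_count]
    ring

theorem signedExcCount_succ_zero (s : ℤˣ) (n : ℕ) :
    (signedExcCount s (n + 1) 0 : ℚ) = signedExcCount s n 0 := by
  simp [signedExcCount_succ]

theorem signedExcCount_succ_succ (s : ℤˣ) (n k : ℕ) :
    (signedExcCount s (n + 1) (k + 1) : ℚ) = signedExcCount s n (k + 1) +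
      (k + 1) * signedExcCount (-s) n (k + 1) + (n - k) * signedExcCount (-s) n k := by
  rw [signedExcCount_succ, signedExcCount_cast (-s) n k]
  simp only [add_left_inj]
  push_cast
  ring

theorem signedExcCount_zero (s : ℤˣ) (k : ℕ) :
    signedExcCount s 0 k = if s = 1 ∧ k = 0 then 1 else 0 := by
  have h (σ : Equiv.Perm (Fin 0)) : (Equiv.Perm.sign σ = s ∧ excA σ = k) ↔ (s = 1 ∧ k = 0) := by
    have : excA σ = 0 := by simp [excA]
    rw [this, Subsingleton.elim σ 1, Equiv.Perm.sign_one, eq_comm, eq_comm (a := 0)]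
  rw [signedExcCount]
  simp_rw [h]
  split_ifs with hh <;> simp [hh]

/-- The Eulerian number counting permutations of `[N + 1]` with `k` excedances, divided by the
binomial coefficient `N.choose k`. -/
def eulerianRatio : ℕ → ℕ → ℚ
  | 0, _ => 1
  | _ + 1, 0 => 1
  | N + 1, k + 1 => ((k + 2) * (N - k) * eulerianRatio N (k + 1) +
      (k + 1) * (N + 1 - k) * eulerianRatio N k) / (N + 1)

theorem eulerianRatio_zero_right (N : ℕ) : eulerianRatio N 0 = 1 := by
  cases N <;> rfl

theorem eulerianRatio_succ_succ (N k : ℕ) :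
    (N + 1) * eulerianRatio (N + 1) (k + 1) = (k + 2) * (N - k) * eulerianRatio N (k + 1) +
      (k + 1) * (N + 1 - k) * eulerianRatio N k := by
  rw [eulerianRatio]
  field_simp

theorem choose_succ_mul_cast (N k : ℕ) :
    (N.choose (k + 1) : ℚ) * (k + 1) = N.choose k * (N - k) := by
  rcases le_or_gt k N with h | h
  · have := Nat.choose_succ_right_eq N k
    rw [← Nat.cast_sub h]
    exact_mod_cast this
  · simp [Nat.choose_eq_zero_of_lt h, Nat.choose_eq_zero_of_lt (h.trans (Nat.lt_succ_self k))]

theorem two_mul_signedExcCount (N : ℕ) : ∀ (s : ℤˣ) (k : ℕ),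
    2 * (signedExcCount s (N + 1) k : ℚ) =
      N.choose k * (eulerianRatio N k + ((s : ℤ) : ℚ) * (-1) ^ k) := by
  induction N with
  | zero =>
    rintro s (_ | k)
    · rw [signedExcCount_succ_zero, signedExcCount_zero]
      rcases Int.units_eq_one_or s with rfl | rfl <;> norm_num [eulerianRatio]
    · rw [signedExcCount_succ_succ, signedExcCount_zero, signedExcCount_zero, signedExcCount_zero]
      rcases k with _ | k <;> simp
  | succ N ih =>
    rintro s (_ | k)
    · rw [signedExcCount_succ_zero, ih]
      simp [eulerianRatio_zero_right]
    · rw [signedExcCount_succ_succ]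
      have h1 := ih s (k + 1)
      have h2 := ih (-s) (k + 1)
      have h3 := ih (-s) k
      have hb := eulerianRatio_succ_succ N k
      have hc := choose_succ_mul_cast N k
      have hp : ((N + 1).choose (k + 1) : ℚ) = N.choose k + N.choose (k + 1) := by
        exact_mod_cast Nat.choose_succ_succ N k
      have hd : ((N + 1).choose (k + 1) : ℚ) * (k + 1) = (N + 1) * N.choose k := by
        rw [hp]; linear_combination hc
      have he : ((N + 1).choose (k + 1) : ℚ) * (N - k) = (N + 1) * N.choose (k + 1) := by
        rw [hp]; linear_combination -hc
      have hN : (N + 1 : ℚ) ≠ 0 := by positivity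
      push_cast at h1 h2 h3 ⊢
      apply mul_left_cancel₀ hN
      have hd' := congrArg (· * ((N + 1 - k) * eulerianRatio N k)) hd
      have he' := congrArg (· * ((k + 2) * eulerianRatio N (k + 1))) he
      rw [pow_succ] at h1 h2 ⊢
      linear_combination (N + 1 : ℚ) * h1 + (N + 1) * (k + 1) * h2 + (N + 1) * (N + 1 - k) * h3
        - ((N + 1).choose (k + 1) : ℚ) * hb - hd' - he'
        + (N + 1 : ℚ) * (s : ℤ) * (-1) ^ k * (hp + hc)

theorem eulerianRatio_self (N : ℕ) : eulerianRatio N N = 1 := by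
  induction N with
  | zero => rfl
  | succ N ih =>
    have h := eulerianRatio_succ_succ N N
    have hN : (N + 1 : ℚ) ≠ 0 := by positivity
    apply mul_left_cancel₀ hN
    rw [h, ih]
    ring

theorem eulerianRatio_pos {N k : ℕ} (h : k ≤ N) : 0 < eulerianRatio N k := by
  induction N generalizing k with
  | zero => norm_num [eulerianRatio]
  | succ N ih =>
    rcases k with _ | k
    · norm_num [eulerianRatio]
    · have hk : (k : ℚ) ≤ N := by exact_mod_cast Nat.le_of_succ_le_succ h
      have h0 := ih (Nat.le_of_succ_le_succ h)
      have h1 : (0 : ℚ) ≤ (k + 2) * (N - k) * eulerianRatio N (k + 1) := by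
        rcases Nat.lt_or_ge k N with hlt | hge
        · have := ih (k := k + 1) hlt
          have : (0 : ℚ) ≤ N - k := by linarith
          positivity
        · have : k = N := by omega
          simp [this]
      have h2 : (0 : ℚ) < N + 1 - k := by linarith
      rw [eulerianRatio]
      positivity

theorem mul_add_le_add_sq_of_logConcave {a b c d : ℚ} (hb : 0 < b) (hc : 0 < c)
    (hd : 0 ≤ d) (h1 : a * c ≤ b ^ 2) (h2 : b * d ≤ c ^ 2) :
    (a + b) * (c + d) ≤ (b + c) ^ 2 := by
  have h3 : a * d ≤ b * c := by
    have h4 : a * c * (b * d) ≤ b ^ 2 * c ^ 2 := by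
      apply mul_le_mul h1 h2 <;> positivity
    by_contra! h
    have := mul_lt_mul_of_pos_right h (mul_pos hb hc)
    linarith [this, h4]
  nlinarith

theorem eulerianRatio_logConcave {N k : ℕ} (h : k + 2 ≤ N) :
    eulerianRatio N k * eulerianRatio N (k + 2) ≤ eulerianRatio N (k + 1) ^ 2 := by
  induction N generalizing k with
  | zero => omega
  | succ N ih =>
    have hk : (k : ℚ) + 1 ≤ N := by exact_mod_cast Nat.le_of_succ_le_succ h
    have e1 := eulerianRatio_succ_succ N k
    have e2 := eulerianRatio_succ_succ N (k + 1)
    have p0 := eulerianRatio_pos (N := N) (k := k) (by omega)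
    have p1 := eulerianRatio_pos (N := N) (k := k + 1) (by omega)
    obtain ⟨a, ha, hac⟩ : ∃ a : ℚ,
        (N + 1) * eulerianRatio (N + 1) k = a + (k + 1) * (N + 1 - k) * eulerianRatio N k ∧
        a * ((k + 2) * (N - k) * eulerianRatio N (k + 1)) ≤
          ((k + 1) * (N + 1 - k) * eulerianRatio N k) ^ 2 := by
      rcases k with _ | j
      · refine ⟨0, ?_, ?_⟩
        · simp [eulerianRatio_zero_right]
        · rw [zero_mul]; positivity
      · refine ⟨(j + 1) * (N + 1 - j) * eulerianRatio N j, ?_, ?_⟩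
        · rw [eulerianRatio_succ_succ]; push_cast; ring
        · have hl := ih (k := j) (by omega)
          have q0 := eulerianRatio_pos (N := N) (k := j) (by omega)
          push_cast at hk ⊢
          have hw : ((j + 1) * (N + 1 - j)) * ((j + 3) * (N - j - 1)) ≤
              (((j : ℚ) + 2) * (N - j)) ^ 2 := by
            have u : ((j : ℚ) + 1) * (j + 3) ≤ (j + 2) ^ 2 := by nlinarith
            have v : ((N : ℚ) + 1 - j) * (N - j - 1) ≤ (N - j) ^ 2 := by nlinarith
            have v0 : 0 ≤ ((N : ℚ) + 1 - j) * (N - j - 1) :=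
              mul_nonneg (by linarith) (by linarith)
            have := mul_le_mul u v v0 (by positivity)
            linarith
          have := mul_le_mul hw hl (mul_nonneg q0.le p1.le) (by positivity)
          linarith
    have hd : 0 ≤ ((k : ℚ) + 3) * (N - k - 1) * eulerianRatio N (k + 2) ∧
        ((k + 1) * (N + 1 - k) * eulerianRatio N k) *
          (((k : ℚ) + 3) * (N - k - 1) * eulerianRatio N (k + 2)) ≤
          ((k + 2) * (N - k) * eulerianRatio N (k + 1)) ^ 2 := by
      rcases Nat.lt_or_ge (k + 1) N with hlt | hge
      · have hl := ih (k := k) hlt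
        have p2 := eulerianRatio_pos (N := N) (k := k + 2) hlt
        have hn : (0 : ℚ) ≤ N - k - 1 := by linarith
        refine ⟨by positivity, ?_⟩
        have hw : ((k + 1) * (N + 1 - k)) * ((k + 3) * (N - k - 1)) ≤
            (((k : ℚ) + 2) * (N - k)) ^ 2 := by
          have u : ((k : ℚ) + 1) * (k + 3) ≤ (k + 2) ^ 2 := by nlinarith
          have v : ((N : ℚ) + 1 - k) * (N - k - 1) ≤ (N - k) ^ 2 := by nlinarith
          have v0 : 0 ≤ ((N : ℚ) + 1 - k) * (N - k - 1) :=
            mul_nonneg (by linarith) (by linarith)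
          have := mul_le_mul u v v0 (by positivity)
          linarith
        have := mul_le_mul hw hl (mul_nonneg p0.le p2.le) (by positivity)
        linarith
      · have hN : (N : ℚ) = k + 1 := by
          have : N = k + 1 := by omega
          rw [this]; push_cast; ring
        rw [hN]
        simp only [add_sub_cancel_left, sub_self, mul_zero, zero_mul, le_refl, true_and]
        positivity
    have hb : (0 : ℚ) < (k + 1) * (N + 1 - k) * eulerianRatio N k := by
      have : (0 : ℚ) < N + 1 - k := by linarith
      positivity
    have hc : (0 : ℚ) < (k + 2) * (N - k) * eulerianRatio N (k + 1) := by
      have : (0 : ℚ) < N - k := by linarith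
      positivity
    have key := mul_add_le_add_sq_of_logConcave hb hc hd.1 hac hd.2
    push_cast at e2
    have e2' : (N + 1) * eulerianRatio (N + 1) (k + 2) =
        (k + 2) * (N - k) * eulerianRatio N (k + 1) +
        (k + 3) * (N - k - 1) * eulerianRatio N (k + 2) := by
      rw [e2]; ring
    have e1' : (N + 1) * eulerianRatio (N + 1) (k + 1) =
        (k + 1) * (N + 1 - k) * eulerianRatio N k +
        (k + 2) * (N - k) * eulerianRatio N (k + 1) := by
      rw [e1]; ring
    rw [← ha, ← e2', ← e1'] at key
    have hpos : (0 : ℚ) < (N + 1) ^ 2 := by positivity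
    refine le_of_mul_le_mul_left ?_ hpos
    linarith

theorem two_mul_le_eulerianRatio {N k : ℕ} (hN : 5 ≤ N) (hk : k + 2 ≤ N) :
    2 * (N : ℚ) ≤ eulerianRatio N (k + 1) := by
  induction N, hN using Nat.le_induction generalizing k with
  | base =>
    have : k < 4 := by omega
    interval_cases k <;> norm_num [eulerianRatio]
  | succ N hN ih =>
    have hN' : (5 : ℚ) ≤ N := by exact_mod_cast hN
    have hk' : (k : ℚ) + 1 ≤ N := by exact_mod_cast Nat.le_of_succ_le_succ hk
    have e := eulerianRatio_succ_succ N k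
    have hpos : (0 : ℚ) < N + 1 := by positivity
    refine le_of_mul_le_mul_left ?_ hpos
    rw [e]
    push_cast
    rcases Nat.eq_zero_or_pos k with rfl | hk0
    · have h1 := ih (k := 0) (by omega)
      rw [eulerianRatio_zero_right]
      push_cast
      nlinarith
    · obtain ⟨j, rfl⟩ : ∃ j, k = j + 1 := ⟨k - 1, by omega⟩
      have h0 := ih (k := j) (by omega)
      push_cast at hk' ⊢
      have hj : (0 : ℚ) ≤ j := by positivity
      rcases Nat.lt_or_ge (j + 2) N with hlt | hge
      · have h1 := ih (k := j + 1) hlt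
        have hlt' : (j : ℚ) + 3 ≤ N := by exact_mod_cast hlt
        have a1 : ((j : ℚ) + 1 + 2) * (N - (j + 1)) * (2 * N) ≤
            (j + 1 + 2) * (N - (j + 1)) * eulerianRatio N (j + 1 + 1) :=
          mul_le_mul_of_nonneg_left h1 (mul_nonneg (by linarith) (by linarith))
        have a2 : ((j : ℚ) + 1 + 1) * (N + 1 - (j + 1)) * (2 * N) ≤
            (j + 1 + 1) * (N + 1 - (j + 1)) * eulerianRatio N (j + 1) :=
          mul_le_mul_of_nonneg_left h0 (mul_nonneg (by linarith) (by linarith))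
        have b1 : 2 * (N : ℚ) - 3 ≤ (j + 1 + 2) * (N - (j + 1)) := by
          nlinarith [mul_nonneg hj (sub_nonneg.2 hlt')]
        have b2 : 2 * (N : ℚ) ≤ (j + 1 + 1) * (N + 1 - (j + 1)) := by
          nlinarith [mul_nonneg hj (sub_nonneg.2 hlt')]
        nlinarith
      · have hNj : N = j + 2 := by omega
        have hs := eulerianRatio_self N
        subst hNj
        rw [hs]
        push_cast at hN' h0 ⊢
        nlinarith

theorem eulerianRatio_gap {N k : ℕ} (hN : 5 ≤ N) (hk : k + 2 ≤ N) :
    ((k : ℚ) + 1) * (N - k - 1) * ((eulerianRatio N k + 1) * (eulerianRatio N (k + 2) + 1)) ≤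
      (k + 2) * (N - k) * (eulerianRatio N (k + 1) - 1) ^ 2 := by
  have hl := eulerianRatio_logConcave hk
  have hx := two_mul_le_eulerianRatio hN hk
  have hN' : (5 : ℚ) ≤ N := by exact_mod_cast hN
  have hk' : (k : ℚ) + 2 ≤ N := by exact_mod_cast hk
  set x := eulerianRatio N (k + 1)
  rcases Nat.eq_zero_or_pos k with hk0 | hk0
  · rw [hk0, eulerianRatio_zero_right, one_mul] at hl
    rw [hk0, eulerianRatio_zero_right]
    push_cast
    have h : ((N : ℚ) - 1) * (eulerianRatio N (0 + 2) + 1) ≤ (N - 1) * (x ^ 2 + 1) :=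
      mul_le_mul_of_nonneg_left (by linarith) (by linarith)
    nlinarith
  rcases Nat.lt_or_ge (k + 2) N with hlt | hge
  · obtain ⟨j, rfl⟩ : ∃ j, k = j + 1 := ⟨k - 1, by omega⟩
    have hy := two_mul_le_eulerianRatio (k := j) hN (by omega)
    have hz := two_mul_le_eulerianRatio (k := j + 2) hN (by omega)
    set y := eulerianRatio N (j + 1)
    change 2 * (N : ℚ) ≤ eulerianRatio N (j + 1 + 2) at hz
    set z := eulerianRatio N (j + 1 + 2)
    push_cast at hk' ⊢
    set p : ℚ := j + 1 + 1 with hp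
    set q : ℚ := N - (j + 1) - 1 with hq
    have hpq : p + q = N := by rw [hp, hq]; ring
    have e1 : (j : ℚ) + 1 + 2 = p + 1 := by rw [hp]; ring
    have e2 : (N : ℚ) - (j + 1) = q + 1 := by rw [hq]; ring
    rw [e1, e2]
    have hp0 : 0 ≤ p := by positivity
    have hq0 : 0 ≤ q := by linarith
    have c1 : (2 * N * (y + 1)) * (2 * N * (z + 1)) ≤ ((2 * N + 1) * y) * ((2 * N + 1) * z) :=
      mul_le_mul (by linarith) (by linarith) (mul_nonneg (by linarith) (by linarith))
        (by nlinarith)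
    have c2 : ((2 * N - 1) * x) ^ 2 ≤ (2 * N * (x - 1)) ^ 2 :=
      pow_le_pow_left₀ (by nlinarith) (by linarith) 2
    have c3 : p * q * (2 * N + 1) ^ 2 ≤ (p + 1) * (q + 1) * (2 * N - 1) ^ 2 := by
      have h4 : 4 * (p * q) ≤ (N : ℚ) ^ 2 := by rw [← hpq]; nlinarith [sq_nonneg (p - q)]
      have h5 : (p + 1) * (q + 1) = p * q + N + 1 := by rw [← hpq]; ring
      rw [h5]
      have h6 : p * q * (8 * N) ≤ (N + 1) * (2 * N - 1) ^ 2 := by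
        have h7 : 4 * (p * q) * (2 * N) ≤ (N : ℚ) ^ 2 * (2 * N) :=
          mul_le_mul_of_nonneg_right h4 (by positivity)
        have h8 : (0 : ℚ) ≤ N * (N * N - 2) := mul_nonneg (by linarith) (by nlinarith)
        nlinarith
      linarith
    have hpos : (0 : ℚ) < 4 * N ^ 2 := by positivity
    refine le_of_mul_le_mul_left ?_ hpos
    calc 4 * (N : ℚ) ^ 2 * (p * q * ((y + 1) * (z + 1)))
        = p * q * ((2 * N * (y + 1)) * (2 * N * (z + 1))) := by ring
      _ ≤ p * q * (((2 * N + 1) * y) * ((2 * N + 1) * z)) :=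
          mul_le_mul_of_nonneg_left c1 (by positivity)
      _ = p * q * (2 * N + 1) ^ 2 * (y * z) := by ring
      _ ≤ p * q * (2 * N + 1) ^ 2 * x ^ 2 := mul_le_mul_of_nonneg_left hl (by positivity)
      _ ≤ (p + 1) * (q + 1) * (2 * N - 1) ^ 2 * x ^ 2 :=
          mul_le_mul_of_nonneg_right c3 (by positivity)
      _ = (p + 1) * (q + 1) * ((2 * N - 1) * x) ^ 2 := by ring
      _ ≤ (p + 1) * (q + 1) * (2 * N * (x - 1)) ^ 2 :=
          mul_le_mul_of_nonneg_left c2 (by positivity)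
      _ = _ := by ring
  · have hNk : N = k + 2 := by omega
    have hs := eulerianRatio_self N
    have hs' : eulerianRatio N (k + 2) = 1 := by rw [← hNk, hs]
    have hkN : (k : ℚ) = N - 2 := by rw [hNk]; push_cast; ring
    rw [hs', mul_one] at hl
    rw [hs', hkN]
    have h : ((N : ℚ) - 1) * (eulerianRatio N k + 1) ≤ (N - 1) * (x ^ 2 + 1) :=
      mul_le_mul_of_nonneg_left (by linarith) (by linarith)
    nlinarith

theorem choose_mul_eulerianRatio_gap {N k : ℕ} (hk : k + 2 ≤ N) :
    (N.choose k * (eulerianRatio N k + 1)) * (N.choose (k + 2) * (eulerianRatio N (k + 2) + 1)) ≤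
      (N.choose (k + 1) * (eulerianRatio N (k + 1) - 1)) ^ 2 := by
  rcases Nat.lt_or_ge N 5 with hN | hN
  · interval_cases N
    · omega
    · omega
    all_goals
      have : k < 3 := by omega
      interval_cases k <;> first | omega | norm_num [eulerianRatio, Nat.choose]
  · have hg := eulerianRatio_gap hN hk
    have hk' : (k : ℚ) + 2 ≤ N := by exact_mod_cast hk
    have h1 := choose_succ_mul_cast N k
    have h2 := choose_succ_mul_cast N (k + 1)
    push_cast at h2
    have hm : ((k : ℚ) + 2) * (N - k) * (N.choose k * N.choose (k + 2)) =
        (k + 1) * (N - k - 1) * (N.choose (k + 1) : ℚ) ^ 2 := by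
      linear_combination (-(k + 2) * (N.choose (k + 2) : ℚ)) * h1 +
        (k + 1) * (N.choose (k + 1) : ℚ) * h2
    have hpos : (0 : ℚ) < (k + 2) * (N - k) := mul_pos (by positivity) (by linarith)
    refine le_of_mul_le_mul_left ?_ hpos
    calc _ = ((k : ℚ) + 2) * (N - k) * (N.choose k * N.choose (k + 2)) *
          ((eulerianRatio N k + 1) * (eulerianRatio N (k + 2) + 1)) := by ring
      _ = (N.choose (k + 1) : ℚ) ^ 2 * ((k + 1) * (N - k - 1) *
          ((eulerianRatio N k + 1) * (eulerianRatio N (k + 2) + 1))) := by rw [hm]; ring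
      _ ≤ (N.choose (k + 1) : ℚ) ^ 2 * ((k + 2) * (N - k) * (eulerianRatio N (k + 1) - 1) ^ 2) :=
          mul_le_mul_of_nonneg_left hg (by positivity)
      _ = _ := by ring

theorem two_mul_signedExcCount_le (s : ℤˣ) (N k : ℕ) :
    2 * (signedExcCount s (N + 1) k : ℚ) ≤ N.choose k * (eulerianRatio N k + 1) := by
  rw [two_mul_signedExcCount]
  gcongr
  rcases Int.units_eq_one_or s with rfl | rfl <;>
    rcases neg_one_pow_eq_or ℚ k with h | h <;> rw [h] <;> norm_num

theorem le_two_mul_signedExcCount (s : ℤˣ) (N k : ℕ) :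
    (N.choose k : ℚ) * (eulerianRatio N k - 1) ≤ 2 * signedExcCount s (N + 1) k := by
  rw [two_mul_signedExcCount, sub_eq_add_neg]
  gcongr
  rcases Int.units_eq_one_or s with rfl | rfl <;>
    rcases neg_one_pow_eq_or ℚ k with h | h <;> rw [h] <;> norm_num

theorem one_le_eulerianRatio {N k : ℕ} (h : k + 2 ≤ N) : 1 ≤ eulerianRatio N (k + 1) := by
  rcases Nat.lt_or_ge N 5 with hN | hN
  · interval_cases N
    · omega
    · omega
    all_goals
      have : k < 3 := by omega
      interval_cases k <;> first | omega | norm_num [eulerianRatio]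
  · have := two_mul_le_eulerianRatio hN h
    have hN' : (5 : ℚ) ≤ N := by exact_mod_cast hN
    linarith

theorem signedExcCount_mul_le_sq {N k : ℕ} (hk : k + 2 ≤ N) (r s t : ℤˣ) :
    signedExcCount r (N + 1) k * signedExcCount t (N + 1) (k + 2) ≤
      signedExcCount s (N + 1) (k + 1) ^ 2 := by
  have h0 : (0 : ℚ) ≤ N.choose (k + 1) * (eulerianRatio N (k + 1) - 1) :=
    mul_nonneg (by positivity) (by linarith [one_le_eulerianRatio hk])
  have hu := two_mul_signedExcCount_le r N k
  have hv := two_mul_signedExcCount_le t N (k + 2)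
  have hw := pow_le_pow_left₀ h0 (le_two_mul_signedExcCount s N (k + 1)) 2
  have hm := mul_le_mul hu hv (by positivity) (le_trans (by positivity) hu)
  have := choose_mul_eulerianRatio_gap hk
  have hq : (signedExcCount r (N + 1) k * signedExcCount t (N + 1) (k + 2) : ℚ) ≤
      (signedExcCount s (N + 1) (k + 1) : ℚ) ^ 2 := by linarith
  exact_mod_cast hq

/-- For every positive integer `n`, any sequence `C = (c_k)_{k=0}^{n-1}` with
`c_k ∈ {P_{n,k}, Q_{n,k}}` for each `0 ≤ k ≤ n-1` is log-concave:
`c_k² ≥ c_{k-1} c_{k+1}` for all `1 ≤ k ≤ n-2`. -/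
theorem typeA_mixed_sequences_log_concave (n : ℕ) (hn : 1 ≤ n) (c : ℕ → ℕ)
    (hc : ∀ k : ℕ, k ≤ n - 1 → c k = P n k ∨ c k = Q n k) :
    ∀ k : ℕ, 1 ≤ k → k ≤ n - 2 → (c k) ^ 2 ≥ c (k - 1) * c (k + 1) := by
  intro k hk1 hk2
  have hs (j : ℕ) (hj : j ≤ n - 1) : ∃ s : ℤˣ, c j = signedExcCount s n j := by
    rcases hc j hj with h | h
    · exact ⟨1, h⟩
    · exact ⟨-1, h⟩
  obtain ⟨N, rfl⟩ : ∃ N, n = N + 1 := ⟨n - 1, by omega⟩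
  obtain ⟨k, rfl⟩ : ∃ j, k = j + 1 := ⟨k - 1, by omega⟩
  obtain ⟨r, hr⟩ := hs k (by omega)
  obtain ⟨s, hs'⟩ := hs (k + 1) (by omega)
  obtain ⟨t, ht⟩ := hs (k + 2) (by omega)
  rw [Nat.add_sub_cancel, hr, hs', show k + 1 + 1 = k + 2 from rfl, ht]
  exact signedExcCount_mul_le_sq (by omega) r s t
end

section
/- For every integer n ≥ 2 and every 1 ≤ k ≤ n, the following recurrences hold: B^+_{n,k} = 2k·B^-_{n-1,k} + (2n−2k+1)·B^-_{n-1,k-1} + B^+_{n-1,k}, and B^-_{n,k} = 2k·B^+_{n-1,k} + (2n−2k+1)·B^+_{n-1,k-1} + B^-_{n-1,k} (with the convention that B^±_{n-1,j} = 0 when j < 0 or j > n-1). -/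
/-- An element of the hyperoctahedral group `B_n`, encoded as a pair `(σ, ε)` of a
permutation of `Fin n` and a sign vector: the corresponding signed permutation sends
`i+1` (for `i : Fin n`) to `±(σ(i)+1)`, and `-(i+1)` to `∓(σ(i)+1)`. -/
abbrev SignedPerm (n : ℕ) := Equiv.Perm (Fin n) × (Fin n → Bool)

/-- The value `π(i+1) ∈ {-n,…,-1,1,…,n}` of the signed permutation at `i+1`. -/
def valB {n : ℕ} (p : SignedPerm n) (i : Fin n) : ℤ :=
  if p.2 i then -((p.1 i : ℤ) + 1) else (p.1 i : ℤ) + 1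

/-- The signed permutation as a function on `ℤ` (value `0` outside `{-n,…,-1,1,…,n}`;
in particular `π(0) = 0`). -/
def appB {n : ℕ} (p : SignedPerm n) (x : ℤ) : ℤ :=
  if h : 1 ≤ x ∧ x ≤ (n : ℤ) then valB p ⟨x.toNat - 1, by omega⟩
  else if h' : 1 ≤ -x ∧ -x ≤ (n : ℤ) then -(valB p ⟨(-x).toNat - 1, by omega⟩)
  else 0

/-- Type B inversions:
`inv_B(π) = |{i<j : π(i)>π(j)}| + |{i<j : -π(i)>π(j)}| + |{i : π(i)<0}|`. -/
def invB {n : ℕ} (p : SignedPerm n) : ℕ :=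
  (Finset.univ.filter (fun ij : Fin n × Fin n =>
      ij.1 < ij.2 ∧ valB p ij.1 > valB p ij.2)).card +
  (Finset.univ.filter (fun ij : Fin n × Fin n =>
      ij.1 < ij.2 ∧ -valB p ij.1 > valB p ij.2)).card +
  (Finset.univ.filter (fun i : Fin n => valB p i < 0)).card

/-- Type B excedances (Brenti):
`exc_B(π) = |{i ∈ [n] : π(|π(i)|) > π(i)}| + |{i ∈ [n] : π(i) = -i}|`. -/
def excB {n : ℕ} (p : SignedPerm n) : ℕ :=
  (Finset.univ.filter (fun i : Fin n => appB p |valB p i| > valB p i)).card +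
  (Finset.univ.filter (fun i : Fin n => valB p i = -((i : ℤ) + 1))).card

/-- Type B descents (with the convention `π(0) = 0`):
`des_B(π) = |{i ∈ {0,…,n-1} : π(i) > π(i+1)}|`. -/
def desB {n : ℕ} (p : SignedPerm n) : ℕ :=
  (Finset.univ.filter (fun i : Fin n => appB p (i : ℤ) > appB p ((i : ℤ) + 1))).card

/-- `PB n k`: number of elements of `B_n^+` (even `inv_B`) with `k` type B excedances. -/
def PB (n k : ℕ) : ℕ :=
  (Finset.univ.filter (fun p : SignedPerm n => Even (invB p) ∧ excB p = k)).card

/-- `QB n k`: number of elements of `B_n^-` (odd `inv_B`) with `k` type B excedances. -/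
def QB (n k : ℕ) : ℕ :=
  (Finset.univ.filter (fun p : SignedPerm n => ¬ Even (invB p) ∧ excB p = k)).card

/-- `Bp n k`: number of elements of `B_n^+` with `k` type B descents. -/
def Bp (n k : ℕ) : ℕ :=
  (Finset.univ.filter (fun p : SignedPerm n => Even (invB p) ∧ desB p = k)).card

/-- `Bm n k`: number of elements of `B_n^-` with `k` type B descents. -/
def Bm (n k : ℕ) : ℕ :=
  (Finset.univ.filter (fun p : SignedPerm n => ¬ Even (invB p) ∧ desB p = k)).card

open Finset

namespace SignedPerm

/-- Insert the letter `±(m+1)` (negative when `b` is true) at position `q`. -/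
def insertMax {m : ℕ} (π : SignedPerm m) (q : Fin (m + 1)) (b : Bool) : SignedPerm (m + 1) :=
  (((finSuccEquiv' q).trans (Equiv.optionCongr π.1)).trans (finSuccEquiv' (Fin.last m)).symm,
    Fin.insertNth (α := fun _ => Bool) q b π.2)

variable {m : ℕ} (π : SignedPerm m) (q : Fin (m + 1)) (b : Bool)

lemma insertMax_fst_self : (insertMax π q b).1 q = Fin.last m := by
  simp [insertMax]

lemma insertMax_fst_succAbove (i : Fin m) :
    (insertMax π q b).1 (q.succAbove i) = (π.1 i).castSucc := by
  simp [insertMax]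

lemma valB_insertMax_self :
    valB (insertMax π q b) q = if b then -((m : ℤ) + 1) else (m : ℤ) + 1 := by
  simp only [valB, insertMax_fst_self]
  simp [insertMax]

lemma valB_insertMax_succAbove (i : Fin m) :
    valB (insertMax π q b) (q.succAbove i) = valB π i := by
  simp only [valB, insertMax_fst_succAbove]
  simp [insertMax]

lemma insertMax_injective : Function.Injective
    (fun x : SignedPerm m × Fin (m + 1) × Bool => insertMax x.1 x.2.1 x.2.2) := by
  rintro ⟨π, q, b⟩ ⟨π', q', b'⟩ h
  simp only at h
  obtain rfl : q = q' := by
    apply (insertMax π q b).1.injective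
    rw [insertMax_fst_self, h, insertMax_fst_self]
  have hb : b = b' := by
    have := congrArg (fun p : SignedPerm (m + 1) => p.2 q) h
    simpa [insertMax] using this
  have h₁ : π.1 = π'.1 := by
    ext i : 1
    apply Fin.castSucc_injective
    rw [← insertMax_fst_succAbove π q b, h, insertMax_fst_succAbove]
  have h₂ : π.2 = π'.2 := by
    funext i
    have := congrArg (fun p : SignedPerm (m + 1) => p.2 (q.succAbove i)) h
    simpa [insertMax] using this
  rw [hb, Prod.ext h₁ h₂]

lemma insertMax_bijective : Function.Bijective
    (fun x : SignedPerm m × Fin (m + 1) × Bool => insertMax x.1 x.2.1 x.2.2) := by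
  rw [Fintype.bijective_iff_injective_and_card]
  refine ⟨insertMax_injective, ?_⟩
  simp only [Fintype.card_prod, Fintype.card_perm, Fintype.card_fin, Fintype.card_pi,
    Fintype.card_bool, Finset.prod_const, Finset.card_univ, Nat.factorial_succ]
  ring

lemma sum_eq_sum_insertMax (f : SignedPerm (m + 1) → ℤ) :
    ∑ p, f p = ∑ π : SignedPerm m, ∑ q, (f (insertMax π q false) + f (insertMax π q true)) := by
  rw [← insertMax_bijective.sum_comp f, Fintype.sum_prod_type]
  refine sum_congr rfl fun π _ => ?_
  rw [Fintype.sum_prod_type]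
  refine sum_congr rfl fun q _ => ?_
  rw [Fintype.sum_bool, add_comm]

lemma abs_valB_le (i : Fin m) : -(m : ℤ) ≤ valB π i ∧ valB π i ≤ m := by
  have := (π.1 i).isLt
  unfold valB
  split_ifs <;> constructor <;> omega

lemma invB_eq_sum : invB π =
    (∑ i, ∑ j, if i < j then
      (if valB π i > valB π j then 1 else 0) + (if -valB π i > valB π j then 1 else 0) else 0) +
    ∑ i, if valB π i < 0 then 1 else 0 := by
  simp only [invB, card_filter, Fintype.sum_prod_type]
  congr 1
  simp only [← sum_add_distrib]
  refine sum_congr rfl fun i _ => sum_congr rfl fun j _ => ?_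
  by_cases h : i < j <;> simp [h]

lemma invB_insertMax : invB (insertMax π q b) = invB π + #{j | q < q.succAbove j} +
    if b then 2 * #{i | q.succAbove i < q} + 1 else 0 := by
  rw [invB_eq_sum, invB_eq_sum]
  simp only [Fin.sum_univ_succAbove _ q, valB_insertMax_self, valB_insertMax_succAbove,
    lt_irrefl, if_false, zero_add, Fin.succAbove_lt_succAbove_iff, sum_add_distrib, card_filter]
  have h₁ (j : Fin m) : (if q < q.succAbove j then
      (if (if b then -((m : ℤ) + 1) else (m : ℤ) + 1) > valB π j then 1 else 0) +
      (if -(if b then -((m : ℤ) + 1) else (m : ℤ) + 1) > valB π j then 1 else 0) else 0) =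
      if q < q.succAbove j then 1 else 0 := by
    have := abs_valB_le π j
    split_ifs <;> first | rfl | omega
  have h₂ (i : Fin m) : (if q.succAbove i < q then
      (if valB π i > (if b then -((m : ℤ) + 1) else (m : ℤ) + 1) then 1 else 0) +
      (if -valB π i > (if b then -((m : ℤ) + 1) else (m : ℤ) + 1) then 1 else 0) else 0) =
      if b then 2 * (if q.succAbove i < q then 1 else 0) else 0 := by
    have := abs_valB_le π i
    split_ifs <;> first | rfl | omega
  simp only [h₁, h₂]
  cases b
  · simp
    split_ifs <;> omega
  · simp only [if_true, ← mul_sum, neg_lt_zero]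
    split_ifs <;> omega

lemma appB_zero : appB π 0 = 0 := by
  simp [appB]

lemma appB_succ (i : Fin m) : appB π ((i : ℤ) + 1) = valB π i := by
  have : (1 : ℤ) ≤ (i : ℤ) + 1 ∧ (i : ℤ) + 1 ≤ m := by omega
  rw [appB, dif_pos this]
  congr 1

lemma abs_appB_le (x : ℤ) : -(m : ℤ) ≤ appB π x ∧ appB π x ≤ m := by
  unfold appB
  split_ifs with h h'
  · exact abs_valB_le π _
  · have := abs_valB_le π ⟨(-x).toNat - 1, by omega⟩
    omega
  · omega

lemma appB_insertMax_of_le {j : ℕ} (hj : j ≤ q) : appB (insertMax π q b) j = appB π j := by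
  rcases j with _ | j
  · simp [appB_zero]
  · have hjm : j < m := by omega
    have h := valB_insertMax_succAbove π q b ⟨j, hjm⟩
    rw [Fin.succAbove_of_castSucc_lt _ _ (by simpa [Fin.lt_def] using hj), ← appB_succ,
      ← appB_succ] at h
    simpa using h

lemma appB_insertMax_self :
    appB (insertMax π q b) ((q : ℤ) + 1) = if b then -((m : ℤ) + 1) else (m : ℤ) + 1 := by
  rw [appB_succ, valB_insertMax_self]

lemma appB_insertMax_of_lt {j : ℕ} (hj : q < j) (hjm : j ≤ m) :
    appB (insertMax π q b) ((j : ℤ) + 1) = appB π j := by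
  obtain ⟨j, rfl⟩ : ∃ i, j = i + 1 := ⟨j - 1, by omega⟩
  have h := valB_insertMax_succAbove π q b ⟨j, hjm⟩
  rw [Fin.succAbove_of_le_castSucc _ _ (by simpa [Fin.le_def] using Nat.le_of_lt_succ hj),
    ← appB_succ, ← appB_succ] at h
  simpa using h

lemma desB_eq_sum :
    desB π = ∑ i ∈ range m, if appB π (i : ℤ) > appB π ((i : ℤ) + 1) then 1 else 0 := by
  rw [desB, card_filter,
    ← Fin.sum_univ_eq_sum_range (fun i => if appB π (i : ℤ) > appB π ((i : ℤ) + 1) then 1 else 0)]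

lemma desB_insertMax_last :
    desB (insertMax π (Fin.last m) b) = desB π + if b then 1 else 0 := by
  rw [desB_eq_sum, desB_eq_sum, sum_range_succ]
  congr 1
  · refine sum_congr rfl fun i hi => ?_
    rw [mem_range] at hi
    have h₁ := appB_insertMax_of_le π (Fin.last m) b (j := i) (by simp; omega)
    have h₂ := appB_insertMax_of_le π (Fin.last m) b (j := i + 1) (by simp; omega)
    push_cast at h₂
    rw [h₁, h₂]
  · have h₁ := appB_insertMax_of_le π (Fin.last m) b (j := m) (by simp)
    have h₂ := appB_insertMax_self π (Fin.last m) b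
    rw [Fin.val_last] at h₂
    rw [h₁, h₂]
    have := abs_appB_le π m
    cases b <;> simp <;> omega

lemma desB_insertMax_castSucc (i : Fin m) :
    desB (insertMax π i.castSucc b) =
      if appB π (i : ℤ) > appB π ((i : ℤ) + 1) then desB π else desB π + 1 := by
  obtain ⟨a, ha⟩ := i
  obtain ⟨c, rfl⟩ : ∃ c, m = a + 1 + c := ⟨m - (a + 1), by omega⟩
  set q : Fin (a + 1 + c + 1) := Fin.castSucc ⟨a, ha⟩
  have hqa : (q : ℕ) = a := rfl
  have hle (j : ℕ) (hj : j ≤ a) := appB_insertMax_of_le π q b (j := j) (by omega)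
  have hself := appB_insertMax_self π q b
  have hlt (j : ℕ) (hj : a < j) (hj' : j ≤ a + 1 + c) :=
    appB_insertMax_of_lt π q b (j := j) (by omega) (by omega)
  rw [hqa] at hself
  have hπ (f : ℕ → ℕ) : ∑ j ∈ range (a + 1 + c), f j =
      ∑ j ∈ range a, f j + f a + ∑ j ∈ range c, f (a + 1 + j) := by
    rw [sum_range_add, sum_range_succ]
  have hins (f : ℕ → ℕ) : ∑ j ∈ range (a + 1 + c + 1), f j =
      ∑ j ∈ range a, f j + f a + f (a + 1) + ∑ j ∈ range c, f (a + 1 + 1 + j) := by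
    rw [add_right_comm, sum_range_add, sum_range_succ, sum_range_succ]
  rw [desB_eq_sum, desB_eq_sum, hins, hπ]
  have e₁ : (∑ j ∈ range a, if appB (insertMax π q b) (j : ℤ) >
      appB (insertMax π q b) ((j : ℤ) + 1) then 1 else 0) =
      ∑ j ∈ range a, if appB π (j : ℤ) > appB π ((j : ℤ) + 1) then 1 else 0 := by
    refine sum_congr rfl fun j hj => ?_
    rw [mem_range] at hj
    have h := hle (j + 1) (by omega)
    push_cast at h
    rw [hle j (by omega), h]
  have e₂ : (∑ j ∈ range c, if appB (insertMax π q b) ((a + 1 + 1 + j : ℕ) : ℤ) >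
      appB (insertMax π q b) (((a + 1 + 1 + j : ℕ) : ℤ) + 1) then 1 else 0) =
      ∑ j ∈ range c, if appB π ((a + 1 + j : ℕ) : ℤ) >
        appB π (((a + 1 + j : ℕ) : ℤ) + 1) then 1 else 0 := by
    refine sum_congr rfl fun j hj => ?_
    rw [mem_range] at hj
    have h := hlt (a + 1 + j) (by omega) (by omega)
    have h' := hlt (a + 1 + j + 1) (by omega) (by omega)
    rw [show ((a + 1 + 1 + j : ℕ) : ℤ) = ((a + 1 + j : ℕ) : ℤ) + 1 by push_cast; ring, h]
    push_cast at h' ⊢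
    rw [h']
  have h₃ := hlt (a + 1) (by omega) (by omega)
  have b₁ := abs_appB_le π a
  have b₂ := abs_appB_le π ((a : ℤ) + 1)
  rw [e₁, e₂, hle a le_rfl, hself]
  push_cast at h₃ b₁ b₂ ⊢
  rw [hself, h₃]
  cases b <;> simp only [if_true, if_false, Bool.false_eq_true] <;> split_ifs <;> omega

lemma sum_desB_insertMax (k : ℕ) :
    ∑ i : Fin m, (if desB (insertMax π i.castSucc b) = k then (1 : ℤ) else 0) =
      (desB π : ℤ) * (if desB π = k then 1 else 0) +
        ((m : ℤ) - desB π) * (if desB π + 1 = k then 1 else 0) := by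
  have h (i : Fin m) : (if desB (insertMax π i.castSucc b) = k then (1 : ℤ) else 0) =
      if appB π (i : ℤ) > appB π ((i : ℤ) + 1) then (if desB π = k then (1 : ℤ) else 0)
      else (if desB π + 1 = k then (1 : ℤ) else 0) := by
    rw [desB_insertMax_castSucc]
    by_cases h : appB π (i : ℤ) > appB π ((i : ℤ) + 1)
    · simp only [if_pos h]
    · simp only [if_neg h]
  have hc := card_filter_add_card_filter_not (s := (univ : Finset (Fin m)))
    (fun i : Fin m => appB π (i : ℤ) > appB π ((i : ℤ) + 1))
  rw [card_univ, Fintype.card_fin, ← desB] at hc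
  simp only [h]
  rw [sum_ite, sum_const, sum_const, ← desB, nsmul_eq_mul, nsmul_eq_mul]
  congr 2
  omega

lemma neg_one_pow_invB_insertMax_true :
    (-1 : ℤ) ^ invB (insertMax π q true) = -(-1) ^ invB (insertMax π q false) := by
  simp [invB_insertMax, pow_add, pow_mul]

lemma invB_insertMax_last_false : invB (insertMax π (Fin.last m) false) = invB π := by
  rw [invB_insertMax]
  simp [Fin.succAbove_last, Fin.le_last]

end SignedPerm

open SignedPerm

lemma Bp_add_Bm (n k : ℕ) : (Bp n k : ℤ) + Bm n k =
    ∑ p : SignedPerm n, if desB p = k then (1 : ℤ) else 0 := by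
  simp only [Bp, Bm, card_filter, Nat.cast_sum, ← sum_add_distrib]
  refine sum_congr rfl fun p _ => ?_
  by_cases h : Even (invB p) <;> simp [h]

lemma Bp_sub_Bm (n k : ℕ) : (Bp n k : ℤ) - Bm n k =
    ∑ p : SignedPerm n, (-1) ^ invB p * if desB p = k then (1 : ℤ) else 0 := by
  simp only [Bp, Bm, card_filter, Nat.cast_sum, ← sum_sub_distrib]
  refine sum_congr rfl fun p _ => ?_
  by_cases h : Even (invB p)
  · simp [h]
  · simp [h, (Nat.not_even_iff_odd.mp h).neg_one_pow, neg_ite]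

/-- The recurrence for the type B Eulerian numbers. -/
lemma Bp_add_Bm_succ (m k : ℕ) : (Bp (m + 1) (k + 1) : ℤ) + Bm (m + 1) (k + 1) =
    (2 * k + 3) * (Bp m (k + 1) + Bm m (k + 1)) + (2 * m - 2 * k + 1) * (Bp m k + Bm m k) := by
  rw [Bp_add_Bm, Bp_add_Bm, Bp_add_Bm, sum_eq_sum_insertMax, mul_sum, mul_sum,
    ← sum_add_distrib]
  refine sum_congr rfl fun π _ => ?_
  rw [Fin.sum_univ_castSucc, sum_add_distrib, sum_desB_insertMax, sum_desB_insertMax,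
    desB_insertMax_last, desB_insertMax_last]
  simp only [if_true, Bool.false_eq_true, if_false, add_zero, Nat.add_right_cancel_iff]
  by_cases h : desB π = k
  · simp [h]
    ring
  · by_cases h' : desB π = k + 1
    · simp [h']
      ring
    · simp [h, h']

lemma sum_neg_one_pow_invB_succ (m k : ℕ) :
    ∑ p : SignedPerm (m + 1), (-1) ^ invB p * (if desB p = k then (1 : ℤ) else 0) =
      ∑ π : SignedPerm m, (-1) ^ invB π *
        ((if desB π = k then (1 : ℤ) else 0) - if desB π + 1 = k then (1 : ℤ) else 0) := by
  rw [sum_eq_sum_insertMax]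
  refine sum_congr rfl fun π _ => ?_
  rw [Fin.sum_univ_castSucc, sum_eq_zero, desB_insertMax_last, desB_insertMax_last,
    neg_one_pow_invB_insertMax_true, invB_insertMax_last_false]
  · simp only [if_true, Bool.false_eq_true, if_false, add_zero]
    ring
  · intro i _
    rw [neg_one_pow_invB_insertMax_true, desB_insertMax_castSucc, desB_insertMax_castSucc]
    ring

/-- The signed type B descent enumerator is `(1 - t) ^ m`. -/
lemma Bp_sub_Bm_eq (m k : ℕ) : (Bp m k : ℤ) - Bm m k = (-1) ^ k * m.choose k := by
  induction m generalizing k with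
  | zero =>
    rw [Bp_sub_Bm]
    cases k <;> simp [invB, desB]
  | succ m ih =>
    rw [Bp_sub_Bm, sum_neg_one_pow_invB_succ]
    cases k with
    | zero => simpa [Bp_sub_Bm] using ih 0
    | succ k =>
      simp only [Nat.add_right_cancel_iff, mul_sub, sum_sub_distrib]
      rw [← Bp_sub_Bm, ← Bp_sub_Bm, ih, ih, Nat.choose_succ_succ]
      push_cast
      ring

/-- **Lemma (Dey–Sivasubramanian).** For every `n ≥ 2` and `1 ≤ k ≤ n`:
`B⁺_{n,k} = 2k·B⁻_{n-1,k} + (2n−2k+1)·B⁻_{n-1,k-1} + B⁺_{n-1,k}` and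
`B⁻_{n,k} = 2k·B⁺_{n-1,k} + (2n−2k+1)·B⁺_{n-1,k-1} + B⁻_{n-1,k}`. -/
theorem typeB_descent_recurrence (n : ℕ) (hn : 2 ≤ n) (k : ℕ) (hk1 : 1 ≤ k)
    (hk : k ≤ n) :
    (Bp n k : ℤ) = 2 * k * (Bm (n - 1) k : ℤ) +
        (2 * (n : ℤ) - 2 * k + 1) * (Bm (n - 1) (k - 1) : ℤ) + (Bp (n - 1) k : ℤ) ∧
      (Bm n k : ℤ) = 2 * k * (Bp (n - 1) k : ℤ) +
        (2 * (n : ℤ) - 2 * k + 1) * (Bp (n - 1) (k - 1) : ℤ) + (Bm (n - 1) k : ℤ) := by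
  obtain ⟨m, rfl⟩ : ∃ m, n = m + 1 := ⟨n - 1, by omega⟩
  obtain ⟨k, rfl⟩ : ∃ j, k = j + 1 := ⟨k - 1, by omega⟩
  have hadd := Bp_add_Bm_succ m k
  have hsub := Bp_sub_Bm_eq (m + 1) (k + 1)
  have h₁ := Bp_sub_Bm_eq m (k + 1)
  have h₂ := Bp_sub_Bm_eq m k
  have hchoose : ((m.choose (k + 1) : ℤ)) * (k + 1) = m.choose k * (m - k) := by
    have := Nat.choose_succ_right_eq m k
    zify [show k ≤ m by omega] at this
    exact this
  rw [Nat.choose_succ_succ] at hsub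
  simp only [Nat.add_sub_cancel]
  push_cast at hsub ⊢
  have hrel : ((k : ℤ) + 1) * (Bp m (k + 1) - Bm m (k + 1)) + (m - k) * (Bp m k - Bm m k) = 0 := by
    rw [h₁, h₂]
    linear_combination (-1 : ℤ) ^ (k + 1) * hchoose
  have hsub' : (Bp (m + 1) (k + 1) : ℤ) - Bm (m + 1) (k + 1) =
      (Bp m (k + 1) - Bm m (k + 1)) - (Bp m k - Bm m k) := by
    rw [hsub, h₁, h₂]
    ring
  constructor <;> linarith
end

section
/- For every positive integer n and every 0 ≤ k ≤ n, P^B_{n,k} − Q^B_{n,k} = (−1)^k · C(n, k), where C(n, k) denotes the binomial coefficient (the difference taken in the integers). -/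
/-- Signed permutations, indexed by the signs carried by the values rather than the positions. -/
def valueSignEquiv (n : ℕ) : Equiv.Perm (Fin n) × (Fin n → Bool) ≃ SignedPerm n where
  toFun p := (p.1, fun i => p.2 (p.1 i))
  invFun p := (p.1, fun i => p.2 (p.1.symm i))
  left_inv p := by simp
  right_inv p := by simp

/-- The signed value `±(j+1)`, with sign prescribed by `τ`. -/
def signedValue {n : ℕ} (τ : Fin n → Bool) (j : Fin n) : ℤ :=
  if τ j then -((j : ℤ) + 1) else (j : ℤ) + 1

lemma valB_valueSignEquiv {n : ℕ} (σ : Equiv.Perm (Fin n)) (τ : Fin n → Bool) (i : Fin n) :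
    valB (valueSignEquiv n (σ, τ)) i = signedValue τ (σ i) := rfl

lemma valB_abs {n : ℕ} (p : SignedPerm n) (i : Fin n) : |valB p i| = (p.1 i : ℤ) + 1 := by
  unfold valB
  split_ifs
  · rw [abs_neg, abs_of_nonneg (by positivity)]
  · rw [abs_of_nonneg (by positivity)]

lemma appB_natCast_add_one {n : ℕ} (p : SignedPerm n) (j : Fin n) :
    appB p ((j : ℤ) + 1) = valB p j := by
  have h : 1 ≤ (j : ℤ) + 1 ∧ (j : ℤ) + 1 ≤ (n : ℤ) := by omega
  rw [appB, dif_pos h]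
  congr 1

lemma pow_card_filter_univ {ι M : Type*} [Fintype ι] [CommMonoid M] (a : M) (P : ι → Prop)
    [DecidablePred P] :
    a ^ (Finset.univ.filter P).card = ∏ i, if P i then a else 1 := by
  rw [Finset.prod_ite]
  simp

lemma neg_one_pow_invB {n : ℕ} (p : SignedPerm n) :
    (-1 : ℤ) ^ invB p =
      (Equiv.Perm.sign p.1 : ℤ) * ∏ i, if p.2 i then (-1 : ℤ) else 1 := by
  rw [invB, pow_add, pow_add, pow_card_filter_univ, pow_card_filter_univ, pow_card_filter_univ,
    ← Finset.prod_mul_distrib]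
  congr 1
  · rw [Equiv.Perm.sign_eq_prod_prod_Ioi, Fintype.prod_prod_type]
    push_cast
    refine Finset.prod_congr rfl fun i _ => ?_
    rw [← Finset.filter_lt_eq_Ioi, Finset.prod_filter]
    refine Finset.prod_congr rfl fun j _ => ?_
    by_cases hij : i < j
    · have hne : (p.1 i : ℕ) ≠ p.1 j := fun h => hij.ne (p.1.injective (Fin.ext h))
      simp only [hij, true_and, if_true, valB, Fin.lt_def]
      split_ifs <;> first | rfl | omega
    · simp [hij]
  · refine Finset.prod_congr rfl fun i _ => ?_
    unfold valB
    split_ifs <;> first | rfl | omega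

open Polynomial in
/-- The matrix whose determinant enumerates, by sign and excedances, the signed permutations
with given signs of values. -/
noncomputable def excMatrix {n : ℕ} (τ : Fin n → Bool) : Matrix (Fin n) (Fin n) ℤ[X] :=
  Matrix.of fun j k =>
    (if signedValue τ k > signedValue τ j then X else 1) * (if k = j ∧ τ j then X else 1)

open Polynomial in
lemma X_pow_excB {n : ℕ} (σ : Equiv.Perm (Fin n)) (τ : Fin n → Bool) :
    (X : ℤ[X]) ^ excB (valueSignEquiv n (σ, τ)) = ∏ j, excMatrix τ j (σ j) := by
  simp only [excMatrix, Matrix.of_apply]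
  rw [excB, pow_add, pow_card_filter_univ, pow_card_filter_univ, Finset.prod_mul_distrib]
  congr 1
  · refine Eq.trans ?_ (Equiv.prod_comp σ _)
    simp only [valB_abs, appB_natCast_add_one]
    rfl
  · refine Finset.prod_congr rfl fun i _ => ?_
    rw [valB_valueSignEquiv]
    refine if_congr ?_ rfl rfl
    rw [signedValue, Fin.ext_iff]
    constructor
    · intro h
      split_ifs at h with hτ
      · have hi : (σ i : ℕ) = i := by omega
        exact ⟨hi, Fin.ext hi ▸ hτ⟩
      · omega
    · rintro ⟨hi, hτ⟩
      rw [Fin.ext hi, if_pos hτ]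

lemma signedValue_injective {n : ℕ} (τ : Fin n → Bool) : Function.Injective (signedValue τ) := by
  intro i j h
  unfold signedValue at h
  ext
  split_ifs at h <;> omega

lemma det_excMatrix_eq_zero {n : ℕ} (τ : Fin n → Bool) {i j : Fin n} (hi : τ i = true)
    (hj : τ j = false) : (excMatrix τ).det = 0 := by
  have : Nonempty (Fin n) := ⟨i⟩
  obtain ⟨a, ha⟩ := Finite.exists_min (signedValue τ)
  obtain ⟨b, hb⟩ := Finite.exists_max (signedValue τ)
  have hτa : τ a = true := by
    by_contra h
    have := ha i
    simp only [signedValue, hi, if_true, h] at this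
    simp at this
    omega
  have hτb : τ b = false := by
    by_contra h
    have := hb j
    simp only [signedValue, hj, eq_true_of_ne_false h] at this
    simp at this
    omega
  have hab : a ≠ b := by
    rintro rfl
    simp [hτa] at hτb
  rw [← Matrix.det_updateRow_add_smul_self _ hab (-Polynomial.X)]
  refine Matrix.det_eq_zero_of_row_eq_zero a fun k => ?_
  have hrow : excMatrix τ a k = Polynomial.X := by
    rcases eq_or_ne k a with rfl | hk
    · simp [excMatrix, hτa]
    · have := lt_of_le_of_ne (ha k) ((signedValue_injective τ).ne hk.symm)
      simp [excMatrix, this, hk]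
  have hrow' : excMatrix τ b k = 1 := by
    simp [excMatrix, hτb, not_lt.2 (hb k)]
  simp [hrow, hrow']

lemma det_ite_le {R : Type*} [CommRing R] (n : ℕ) (a b : R) :
    (Matrix.of fun j k : Fin (n + 1) => if k ≤ j then a else b).det = a * (a - b) ^ n := by
  let B : Matrix (Fin (n + 1)) (Fin (n + 1)) R :=
    Matrix.of fun j k => Fin.cases (if k = 0 then a else b)
      (fun i => if k = i.succ then a - b else 0) j
  have hB : B.BlockTriangular id := by
    intro i j hij
    cases i using Fin.cases with
    | zero => simp at hij
    | succ i => simpa [B] using fun h : j = i.succ => absurd hij (by simp [h])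
  rw [Matrix.det_eq_of_forall_row_eq_smul_add_pred (B := B) (fun _ => 1),
    Matrix.det_of_isUpperTriangular hB, Fin.prod_univ_succ]
  · simp [B]
  · intro j
    simp [B]
  · intro i j
    simp only [B, Matrix.of_apply, Fin.cases_succ, one_mul, Fin.le_def, Fin.ext_iff,
      Fin.val_succ, Fin.val_castSucc]
    split_ifs <;> first | omega | ring

open Polynomial in
lemma det_excMatrix_false (n : ℕ) :
    (excMatrix (fun _ : Fin (n + 1) => false)).det = (1 - X) ^ n := by
  rw [← one_mul ((1 - X : ℤ[X]) ^ n), ← det_ite_le n 1 X]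
  congr 1
  ext1 j k
  simp only [excMatrix, signedValue, Matrix.of_apply, Fin.le_def]
  split_ifs <;> first | omega | simp_all

open Polynomial in
lemma det_excMatrix_true (n : ℕ) :
    (excMatrix (fun _ : Fin (n + 1) => true)).det = X * (X - 1) ^ n := by
  rw [← det_ite_le n X 1]
  congr 1
  ext1 j k
  simp only [excMatrix, signedValue, Matrix.of_apply, Fin.le_def, Fin.ext_iff,
    and_true, if_true]
  split_ifs <;> first | omega | simp

open Polynomial in
lemma sum_neg_one_pow_invB_mul_X_pow_excB (n : ℕ) :
    ∑ p : SignedPerm (n + 1), C ((-1 : ℤ) ^ invB p) * X ^ excB p = (1 - X) ^ (n + 1) := by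
  have hdet : ∑ p : SignedPerm (n + 1), C ((-1 : ℤ) ^ invB p) * X ^ excB p =
      ∑ τ : Fin (n + 1) → Bool,
        C (∏ i, if τ i then (-1 : ℤ) else 1) * (excMatrix τ).det := by
    rw [← Equiv.sum_comp (valueSignEquiv (n + 1)), Fintype.sum_prod_type_right]
    refine Finset.sum_congr rfl fun τ _ => ?_
    rw [← Matrix.det_transpose, Matrix.det_apply', Finset.mul_sum]
    refine Finset.sum_congr rfl fun σ _ => ?_
    rw [X_pow_excB, neg_one_pow_invB]
    have : ∏ i, (if (valueSignEquiv (n + 1) (σ, τ)).2 i then (-1 : ℤ) else 1) =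
        ∏ i, if τ i then (-1 : ℤ) else 1 :=
      Equiv.prod_comp σ fun i => if τ i then (-1 : ℤ) else 1
    rw [this]
    simp only [valueSignEquiv, Equiv.coe_fn_mk, Matrix.transpose_apply, C_mul]
    simp only [eq_intCast]
    ring
  have hne : (fun _ : Fin (n + 1) => false) ≠ fun _ => true := fun h => by
    simpa using congrFun h 0
  rw [hdet, Fintype.sum_eq_add _ _ hne, det_excMatrix_false, det_excMatrix_true]
  · have : (X - 1 : ℤ[X]) = -1 * (1 - X) := by ring
    simp only [this, mul_pow, Bool.false_eq_true, if_false, if_true, Finset.prod_const_one,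
      Finset.prod_const, Finset.card_univ, Fintype.card_fin, map_pow, map_neg, map_one]
    have h1 : ((-1 : ℤ[X]) ^ n) * (-1) ^ n = 1 := by rw [← mul_pow]; simp
    linear_combination (-X * (1 - X) ^ n) * h1
  · rintro τ ⟨h₁, h₂⟩
    obtain ⟨i, hi⟩ := Function.ne_iff.1 h₁
    obtain ⟨j, hj⟩ := Function.ne_iff.1 h₂
    rw [det_excMatrix_eq_zero τ (by simpa using hi) (by simpa using hj), mul_zero]

lemma PB_sub_QB (n k : ℕ) :
    (PB n k : ℤ) - QB n k = ∑ p : SignedPerm n, if excB p = k then (-1 : ℤ) ^ invB p else 0 := by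
  rw [PB, QB, Finset.natCast_card_filter, Finset.natCast_card_filter, ← Finset.sum_sub_distrib]
  refine Finset.sum_congr rfl fun p _ => ?_
  by_cases hk : excB p = k <;> by_cases he : Even (invB p)
  · simp [hk, he]
  · simp [hk, he, (Nat.not_even_iff_odd.1 he).neg_one_pow]
  · simp [hk]
  · simp [hk]

lemma coeff_one_sub_X_pow_eq (n k : ℕ) :
    ((1 - Polynomial.X : Polynomial ℤ) ^ n).coeff k = (-1) ^ k * (n.choose k : ℤ) := by
  have h : (1 - Polynomial.X : Polynomial ℤ) = (1 + Polynomial.X).comp (-1 * Polynomial.X) := by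
    simp [sub_eq_add_neg]
  have h' : (-1 * Polynomial.X : Polynomial ℤ) = Polynomial.C (-1) * Polynomial.X := by simp
  rw [h, ← Polynomial.pow_comp, h', Polynomial.comp_C_mul_X_coeff, Polynomial.coeff_one_add_X_pow,
    mul_comm]

/-- **Theorem (Sivasubramanian).** For every positive integer `n` and every `0 ≤ k ≤ n`,
`P^B_{n,k} − Q^B_{n,k} = (−1)^k · C(n, k)` (in the integers). -/
theorem typeB_excedance_difference (n : ℕ) (hn : 1 ≤ n) (k : ℕ) (hk : k ≤ n) :
    (PB n k : ℤ) - (QB n k : ℤ) = (-1) ^ k * (Nat.choose n k : ℤ) := by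
  obtain ⟨n, rfl⟩ := Nat.exists_eq_add_of_le' hn
  rw [PB_sub_QB, ← coeff_one_sub_X_pow_eq, ← sum_neg_one_pow_invB_mul_X_pow_excB,
    Polynomial.finsetSum_coeff]
  refine Finset.sum_congr rfl fun p _ => ?_
  rw [Polynomial.coeff_C_mul, Polynomial.coeff_X_pow]
  simp [eq_comm]
end
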